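/- arXiv:1403.3148 — 4 statements merged into one kernel-verified Lean document; each statement's English description precedes it below -/
import Mathlib

section
/- Let t ∈ ℝ, let s ∈ ℝ^n be any vector, and let v̂ ∈ ℝ^{(N+1)n} be any vector with blocks v̂_0, …, v̂_N ∈ ℝ^n. Define the residual r = e_1 ⊗ s − (I_{(N+1)n} − S ⊗ (tP)) v̂ with blocks r_0, …, r_N ∈ ℝ^n, and set y = v̂_0 + v̂_1 + ⋯ + v̂_N. Then T_N(tP) s − y = Σ_{k=0}^N ψ_k(tP) r_k, where ψ_k(tP) denotes the matrix polynomial Σ_{m=0}^{N−k} (k!/(m+k)!) (tP)^m. -/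
open Matrix Finset
open scoped Kronecker

/-- ψ_k(t) = Σ_{m=0}^{N−k} (k!/(m+k)!) t^m -/
noncomputable def psi (N k : ℕ) (t : ℝ) : ℝ :=
  ∑ m ∈ Finset.range (N - k + 1), ((Nat.factorial k : ℝ) / (Nat.factorial (m + k))) * t ^ m

/-- ψ_k applied to a matrix: Σ_{m=0}^{N−k} (k!/(m+k)!) M^m -/
noncomputable def psiMat (N k : ℕ) {n : ℕ} (M : Matrix (Fin n) (Fin n) ℝ) :
    Matrix (Fin n) (Fin n) ℝ :=
  ∑ m ∈ Finset.range (N - k + 1), ((Nat.factorial k : ℝ) / (Nat.factorial (m + k))) • M ^ m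

/-- The (N+1)×(N+1) matrix with subdiagonal entries S_{j+1,j} = 1/j (1-based indexing). -/
noncomputable def Smat (N : ℕ) : Matrix (Fin (N + 1)) (Fin (N + 1)) ℝ :=
  Matrix.of fun i j => if (i : ℕ) = (j : ℕ) + 1 then 1 / ((j : ℕ) + 1) else 0

/-- The random-walk transition matrix P = A D⁻¹. -/
noncomputable def transP {n : ℕ} (G : SimpleGraph (Fin n)) [DecidableRel G.Adj] :
    Matrix (Fin n) (Fin n) ℝ :=
  G.adjMatrix ℝ * Matrix.diagonal (fun i => ((G.degree i : ℝ))⁻¹)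

/-- The inverse degree matrix D⁻¹. -/
noncomputable def Dinv {n : ℕ} (G : SimpleGraph (Fin n)) [DecidableRel G.Adj] :
    Matrix (Fin n) (Fin n) ℝ :=
  Matrix.diagonal (fun i => ((G.degree i : ℝ))⁻¹)

theorem psiMat_self (N : ℕ) {n : ℕ} (M : Matrix (Fin n) (Fin n) ℝ) : psiMat N N M = 1 := by
  simp [psiMat, Nat.factorial_ne_zero]

/-- The recursion `ψ_k = 1 + ψ_{k+1} M / (k+1)` for `k < N`. -/
theorem psiMat_of_lt {N k : ℕ} (hk : k < N) {n : ℕ} (M : Matrix (Fin n) (Fin n) ℝ) :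
    psiMat N k M = 1 + (1 / ((k : ℝ) + 1)) • (psiMat N (k + 1) M * M) := by
  unfold psiMat
  rw [Finset.sum_range_succ', add_comm, show N - (k + 1) + 1 = N - k by omega,
    Finset.sum_mul, Finset.smul_sum]
  congr 1
  · simp [Nat.factorial_ne_zero]
  · refine Finset.sum_congr rfl fun m _ => ?_
    rw [Matrix.smul_mul, ← pow_succ, smul_smul, show m + 1 + k = m + (k + 1) by ring,
      Nat.factorial_succ k]
    congr 1
    push_cast
    field_simp

/-- The polynomial `ψ_0` is the Taylor polynomial of the exponential. -/
theorem psiMat_zero_smul (N : ℕ) {n : ℕ} (t : ℝ) (P : Matrix (Fin n) (Fin n) ℝ) :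
    psiMat N 0 (t • P) = ∑ k ∈ Finset.range (N + 1), (t ^ k / (Nat.factorial k : ℝ)) • P ^ k := by
  unfold psiMat
  refine Finset.sum_congr rfl fun k _ => ?_
  rw [smul_pow, smul_smul]
  congr 1
  simp
  ring

theorem kronecker_Smat_mulVec_zero {n N : ℕ} (M : Matrix (Fin n) (Fin n) ℝ)
    (v : Fin (N + 1) × Fin n → ℝ) (i : Fin n) : ((Smat N ⊗ₖ M) *ᵥ v) (0, i) = 0 := by
  simp [Matrix.mulVec, dotProduct, Smat, Matrix.kroneckerMap_apply]

theorem kronecker_Smat_mulVec_succ {n N : ℕ} (M : Matrix (Fin n) (Fin n) ℝ)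
    (v : Fin (N + 1) × Fin n → ℝ) (j : Fin N) (i : Fin n) :
    ((Smat N ⊗ₖ M) *ᵥ v) (j.succ, i) =
      (1 / ((j : ℝ) + 1)) * (M *ᵥ fun l => v (j.castSucc, l)) i := by
  simp only [Matrix.mulVec, dotProduct, Matrix.kroneckerMap_apply, Fintype.sum_prod_type,
    Finset.mul_sum]
  rw [Finset.sum_eq_single j.castSucc]
  · refine Finset.sum_congr rfl fun l _ => ?_
    simp [Smat, mul_assoc]
  · intro b _ hb
    have h : ¬ ((j : ℕ) = (b : ℕ)) := fun h => hb (Fin.ext h.symm)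
    simp [Smat, h]
  · simp

/-- the error of any approximate solution of the block linear system is a
weighted sum of the residual blocks, `T_N(tP) s − y = Σ_{k=0}^N ψ_k(tP) r_k`. -/
theorem stmt1 {n N : ℕ} (hN : 1 ≤ N)
    (G : SimpleGraph (Fin n)) [DecidableRel G.Adj]
    (hdeg : ∀ i, 1 ≤ G.degree i)
    (t : ℝ) (s : Fin n → ℝ)
    (vhat r : Fin (N + 1) × Fin n → ℝ)
    (hr : r = (fun p => if p.1 = 0 then s p.2 else 0) -
        ((1 : Matrix (Fin (N + 1) × Fin n) (Fin (N + 1) × Fin n) ℝ)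
            - Smat N ⊗ₖ (t • transP G)).mulVec vhat)
    (y : Fin n → ℝ)
    (hy : y = fun i => ∑ j : Fin (N + 1), vhat (j, i)) :
    (∑ k ∈ Finset.range (N + 1),
        (t ^ k / (Nat.factorial k : ℝ)) • (transP G ^ k).mulVec s) - y
      = ∑ j : Fin (N + 1),
          (psiMat N (j : ℕ) (t • transP G)).mulVec (fun i => r (j, i)) := by
  set M := t • transP G with hM
  have hr_zero : (fun i => r (0, i)) = s - fun i => vhat (0, i) := by
    funext i
    simp [hr, Matrix.sub_mulVec, kronecker_Smat_mulVec_zero]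
  have hr_succ (j : Fin N) : (fun i => r (j.succ, i)) =
      (1 / ((j : ℝ) + 1)) • (M *ᵥ fun i => vhat (j.castSucc, i)) -
        fun i => vhat (j.succ, i) := by
    funext i
    simp [hr, Matrix.sub_mulVec, kronecker_Smat_mulVec_succ]
  have hpsi (j : Fin N) :
      psiMat N (j + 1) M *ᵥ ((1 / ((j : ℝ) + 1)) • (M *ᵥ fun i => vhat (j.castSucc, i))) =
        (psiMat N j M *ᵥ fun i => vhat (j.castSucc, i)) - fun i => vhat (j.castSucc, i) := by
    rw [psiMat_of_lt j.isLt, Matrix.add_mulVec, Matrix.one_mulVec, add_sub_cancel_left,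
      Matrix.mulVec_smul, Matrix.mulVec_mulVec, Matrix.smul_mulVec]
  have hT : (∑ k ∈ Finset.range (N + 1),
      (t ^ k / (Nat.factorial k : ℝ)) • (transP G ^ k).mulVec s) = psiMat N 0 M *ᵥ s := by
    simp only [hM, psiMat_zero_smul, Matrix.sum_mulVec, Matrix.smul_mulVec]
  have hy_sum : y = ∑ j : Fin (N + 1), fun i => vhat (j, i) := by
    funext i
    simp [hy]
  have hshift := (Fin.sum_univ_succ fun j : Fin (N + 1) =>
    psiMat N j M *ᵥ fun i => vhat (j, i)).symm.trans (Fin.sum_univ_castSucc _)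
  simp only [Fin.val_zero, Fin.val_succ, Fin.val_castSucc, Fin.val_last, psiMat_self,
    Matrix.one_mulVec] at hshift
  rw [hT, hy_sum, Fin.sum_univ_castSucc, Fin.sum_univ_succ]
  simp only [Fin.val_zero, Fin.val_succ, hr_zero, hr_succ, Matrix.mulVec_sub, hpsi,
    Finset.sum_sub_distrib]
  rw [← sub_eq_zero] at hshift ⊢
  rw [← hshift]
  abel
end

section
/- Let M be any real n×n matrix, z ∈ ℝ^n, and 1 ≤ j ≤ N+1. Then (e^T ⊗ I_n) (Σ_{m=0}^N S^m ⊗ M^m) (e_j ⊗ z) = Σ_{m=0}^{N+1−j} ((j−1)!/(j−1+m)!) M^m z. In particular, taking M = tP, the coefficient matrix acting on the residual block in position j of the block linear system is ψ_{j−1}(tP) = Σ_{m=0}^{N−(j−1)} ((j−1)!/(j−1+m)!) t^m P^m. -/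
open Matrix Finset
open scoped Kronecker

/-- Entries of the powers of `Smat`: only the `m`-th subdiagonal survives. -/
theorem Smat_pow_apply (N m : ℕ) (l j : Fin (N + 1)) :
    (Smat N ^ m) l j =
      if (l : ℕ) = j + m then (Nat.factorial j : ℝ) / Nat.factorial (j + m) else 0 := by
  induction m generalizing j with
  | zero =>
    have hj : (Nat.factorial j : ℝ) ≠ 0 := by positivity
    simp [Matrix.one_apply, Fin.ext_iff, hj]
  | succ m ih =>
    rw [pow_succ, Matrix.mul_apply]
    by_cases hj : (j : ℕ) + 1 < N + 1
    · rw [Finset.sum_eq_single (⟨j + 1, hj⟩ : Fin (N + 1))]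
      · have hf : (Nat.factorial (j + 1 + m) : ℝ) ≠ 0 := by positivity
        have hj' : (j : ℝ) + 1 ≠ 0 := by positivity
        rw [ih, show (j : ℕ) + (m + 1) = j + 1 + m by ring]
        simp only [Smat, Matrix.of_apply, if_true, Nat.factorial_succ (j : ℕ), ite_mul, zero_mul]
        congr 1
        push_cast
        field_simp
      · intro k _ hk
        have hk' : (k : ℕ) ≠ j + 1 := fun h => hk (Fin.ext h)
        simp [Smat, hk']
      · simp
    · have hl : (l : ℕ) ≠ j + (m + 1) := by omega
      rw [if_neg hl]
      refine Finset.sum_eq_zero fun k _ => ?_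
      have hk : (k : ℕ) ≠ j + 1 := by omega
      simp [Smat, hk]

/-- Column sums of the powers of `Smat`. -/
theorem sum_Smat_pow_apply (N m : ℕ) (j : Fin (N + 1)) :
    ∑ l, (Smat N ^ m) l j =
      if m < N - (j : ℕ) + 1 then (Nat.factorial j : ℝ) / Nat.factorial (j + m) else 0 := by
  simp only [Smat_pow_apply]
  split_ifs with h
  · rw [Finset.sum_eq_single (⟨j + m, by omega⟩ : Fin (N + 1))]
    · simp
    · intro k _ hk
      exact if_neg fun h => hk (Fin.ext h)
    · simp
  · exact Finset.sum_eq_zero fun l _ => if_neg (by omega)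

/-- A Kronecker product acting on the block vector `e_j ⊗ z`. -/
theorem kronecker_mulVec_single_block {ι κ R : Type*} [Fintype ι] [Fintype κ] [DecidableEq ι]
    [CommSemiring R] (A : Matrix ι ι R) (B : Matrix κ κ R) (z : κ → R) (j l : ι) (i : κ) :
    ((A ⊗ₖ B).mulVec fun p => if p.1 = j then z p.2 else 0) (l, i) =
      A l j * B.mulVec z i := by
  simp only [Matrix.mulVec, dotProduct, Fintype.sum_prod_type, Matrix.kroneckerMap_apply,
    mul_ite, mul_zero]
  rw [Finset.sum_eq_single j]
  · simp [Finset.mul_sum, mul_assoc]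
  · intro k _ hk
    simp [hk]
  · simp

/-- summing the blocks of `(Σ_{m=0}^N S^m ⊗ M^m)(e_j ⊗ z)` (this is the
action of `(eᵀ ⊗ I_n)`) gives `Σ_{m=0}^{N+1−j} ((j−1)!/(j−1+m)!) M^m z` (1-based `j`;
here `j : Fin (N+1)` is 0-based so the limit is `N − j` and the coefficient is
`j!/(j+m)!`).  In particular, taking `M = tP`, the coefficient matrix acting on
residual block `j` is `ψ_{j−1}(tP) = Σ_m ((j−1)!/(j−1+m)!) t^m P^m`. -/
theorem stmt5 {n N : ℕ} (hN : 1 ≤ N) (M : Matrix (Fin n) (Fin n) ℝ) (z : Fin n → ℝ)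
    (j : Fin (N + 1)) :
    (fun i : Fin n =>
        ∑ l : Fin (N + 1),
          ((∑ m ∈ Finset.range (N + 1), (Smat N ^ m) ⊗ₖ (M ^ m)).mulVec
              fun p => if p.1 = j then z p.2 else 0) (l, i))
        = ∑ m ∈ Finset.range (N - (j : ℕ) + 1),
            ((Nat.factorial (j : ℕ) : ℝ) / (Nat.factorial ((j : ℕ) + m))) •
              (M ^ m).mulVec z
      ∧ ∀ (t : ℝ) (P : Matrix (Fin n) (Fin n) ℝ),
          ∑ m ∈ Finset.range (N - (j : ℕ) + 1),
              ((Nat.factorial (j : ℕ) : ℝ) / (Nat.factorial ((j : ℕ) + m))) • (t • P) ^ m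
            = ∑ m ∈ Finset.range (N - (j : ℕ) + 1),
                ((Nat.factorial (j : ℕ) : ℝ) / (Nat.factorial ((j : ℕ) + m)) * t ^ m) •
                  P ^ m := by
  refine ⟨?_, fun t P => ?_⟩
  · funext i
    simp only [Matrix.sum_mulVec, Finset.sum_apply, kronecker_mulVec_single_block, Pi.smul_apply,
      smul_eq_mul]
    rw [Finset.sum_comm]
    simp only [← Finset.sum_mul, sum_Smat_pow_apply, ite_mul, zero_mul]
    rw [← Finset.sum_filter]
    refine Finset.sum_congr ?_ fun _ _ => rfl
    ext m
    simp only [Finset.mem_filter, Finset.mem_range]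
    omega
  · simp only [smul_pow, smul_smul]
end

section
/- For every t ≥ 0, every k with 0 ≤ k ≤ N, and every vector z ∈ ℝ^n, the following holds: ‖D^{-1} ψ_k(tP) z‖_∞ ≤ ψ_k(t) · ‖D^{-1} z‖_∞, where ψ_k(tP) denotes the matrix polynomial Σ_{m=0}^{N−k} (k!/(m+k)!) (tP)^m. -/
open Matrix Finset
open scoped Kronecker

/-- One step of the random walk does not increase `‖D⁻¹ z‖_∞`. -/
theorem norm_Dinv_mulVec_transP_mulVec_le {n : ℕ} (G : SimpleGraph (Fin n)) [DecidableRel G.Adj]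
    (z : Fin n → ℝ) :
    ‖Dinv G *ᵥ (transP G *ᵥ z)‖ ≤ ‖Dinv G *ᵥ z‖ := by
  have h : transP G *ᵥ z = G.adjMatrix ℝ *ᵥ (Dinv G *ᵥ z) := by
    rw [transP, Dinv, Matrix.mulVec_mulVec]
  rw [h]
  generalize Dinv G *ᵥ z = w
  refine (pi_norm_le_iff_of_nonneg (norm_nonneg w)).2 fun i => ?_
  rw [Dinv, Matrix.mulVec_diagonal, SimpleGraph.adjMatrix_mulVec_apply, norm_mul, norm_inv,
    Real.norm_natCast]
  have hsum : ‖∑ u ∈ G.neighborFinset i, w u‖ ≤ G.degree i * ‖w‖ := by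
    simpa using norm_sum_le_of_le (G.neighborFinset i) fun j _ => norm_le_pi_norm w j
  exact inv_mul_le_of_le_mul₀ (Nat.cast_nonneg _) (norm_nonneg w) hsum

theorem norm_Dinv_mulVec_transP_pow_mulVec_le {n : ℕ} (G : SimpleGraph (Fin n))
    [DecidableRel G.Adj] (z : Fin n → ℝ) (m : ℕ) :
    ‖Dinv G *ᵥ ((transP G ^ m) *ᵥ z)‖ ≤ ‖Dinv G *ᵥ z‖ := by
  induction m with
  | zero => simp
  | succ m ih =>
    rw [pow_succ', ← Matrix.mulVec_mulVec]
    exact (norm_Dinv_mulVec_transP_mulVec_le G _).trans ih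

/-- `‖D⁻¹ ψ_k(tP) z‖_∞ ≤ ψ_k(t) ‖D⁻¹ z‖_∞` (the Pi norm on `Fin n → ℝ`
is the sup norm). -/
theorem stmt6 {n N : ℕ} (hN : 1 ≤ N)
    (G : SimpleGraph (Fin n)) [DecidableRel G.Adj]
    (hdeg : ∀ i, 1 ≤ G.degree i)
    (t : ℝ) (ht : 0 ≤ t) (k : ℕ) (hk : k ≤ N) (z : Fin n → ℝ) :
    ‖(Dinv G).mulVec ((psiMat N k (t • transP G)).mulVec z)‖
      ≤ psi N k t * ‖(Dinv G).mulVec z‖ := by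
  rw [psiMat, psi, Matrix.sum_mulVec, Matrix.mulVec_sum, Finset.sum_mul]
  refine norm_sum_le_of_le _ fun m _ => ?_
  have hc : 0 ≤ (Nat.factorial k : ℝ) / Nat.factorial (m + k) * t ^ m := by positivity
  rw [smul_pow, smul_smul, Matrix.smul_mulVec, Matrix.mulVec_smul, norm_smul,
    Real.norm_of_nonneg hc]
  exact mul_le_mul_of_nonneg_left (norm_Dinv_mulVec_transP_pow_mulVec_le G z m) hc
end

section
/- Let t > 0, ε > 0, and N ≥ 1. Suppose T is a positive integer and for each l = 1, …, T we are given a real number d_l ≥ 1, an index j_l ∈ {1, …, N}, and a real number r_l satisfying r_l ≥ e^t ε d_l / (2 N ψ_{j_l}(t)). If Σ_{l=1}^T r_l ≤ e^t, then Σ_{l=1}^T d_l ≤ 2 N ψ_1(t)/ε ≤ 2 N (e^t − 1)/(t ε). -/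
lemma factorial_mul_factorial_succ_le {k : ℕ} (hk : 1 ≤ k) (m : ℕ) :
    k.factorial * (m + 1).factorial ≤ (m + k).factorial := by
  induction m with
  | zero => simp
  | succ m ih =>
    rw [show m + 1 + k = (m + k) + 1 by ring, Nat.factorial_succ (m + k),
      Nat.factorial_succ (m + 1)]
    calc k.factorial * ((m + 1 + 1) * (m + 1).factorial)
        = (m + 1 + 1) * (k.factorial * (m + 1).factorial) := by ring
      _ ≤ (m + k + 1) * (m + k).factorial := Nat.mul_le_mul (by omega) ih

lemma psi_pos (N k : ℕ) {t : ℝ} (ht : 0 < t) : 0 < psi N k t :=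
  Finset.sum_pos (fun m _ => by positivity) (by simp)

lemma psi_le_psi_one (N : ℕ) {k : ℕ} (hk : 1 ≤ k) {t : ℝ} (ht : 0 ≤ t) :
    psi N k t ≤ psi N 1 t := by
  unfold psi
  calc _ ≤ ∑ m ∈ Finset.range (N - k + 1),
        ((Nat.factorial 1 : ℝ) / (Nat.factorial (m + 1))) * t ^ m := by
        refine Finset.sum_le_sum fun m _ => mul_le_mul_of_nonneg_right ?_ (by positivity)
        rw [div_le_div_iff₀ (by positivity) (by positivity), Nat.factorial_one, Nat.cast_one,
          one_mul]
        exact_mod_cast factorial_mul_factorial_succ_le hk m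
    _ ≤ _ := Finset.sum_le_sum_of_subset_of_nonneg
        (Finset.range_mono (by omega)) fun m _ _ => by positivity

lemma mul_psi_one_le {N : ℕ} (hN : 1 ≤ N) {t : ℝ} (ht : 0 ≤ t) :
    t * psi N 1 t ≤ Real.exp t - 1 := by
  have h := Real.sum_le_exp_of_nonneg ht (N + 1)
  rw [Finset.sum_range_succ'] at h
  have e : t * psi N 1 t = ∑ m ∈ Finset.range N, t ^ (m + 1) / ((m + 1).factorial : ℝ) := by
    rw [psi, Nat.sub_add_cancel hN, Finset.mul_sum]
    refine Finset.sum_congr rfl fun m _ => ?_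
    rw [Nat.factorial_one, Nat.cast_one]
    ring
  simp only [pow_zero, Nat.factorial_zero, Nat.cast_one, div_one] at h
  linarith

/-- arithmetic core of the work bound `2Nψ_1(t)/ε ≤ 2N(e^t−1)/(tε)`. -/
theorem stmt14 (N : ℕ) (hN : 1 ≤ N) (t ε : ℝ) (ht : 0 < t) (hε : 0 < ε)
    (T : ℕ) (hT : 0 < T) (d r : Fin T → ℝ) (j : Fin T → ℕ)
    (hd : ∀ l, 1 ≤ d l) (hj1 : ∀ l, 1 ≤ j l) (hj2 : ∀ l, j l ≤ N)
    (hr : ∀ l, Real.exp t * ε * d l / (2 * N * psi N (j l) t) ≤ r l)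
    (hsum : ∑ l, r l ≤ Real.exp t) :
    ∑ l, d l ≤ 2 * N * psi N 1 t / ε
      ∧ 2 * N * psi N 1 t / ε ≤ 2 * N * (Real.exp t - 1) / (t * ε) := by
  have hN0 : (0 : ℝ) < N := by exact_mod_cast hN
  have hψ := psi_pos N 1 ht
  constructor
  · have key : ∀ l, d l ≤ r l * (2 * N * psi N 1 t / (Real.exp t * ε)) := by
      intro l
      have hψl := psi_pos N (j l) ht
      have hdl : 0 < d l := one_pos.trans_le (hd l)
      have hle : Real.exp t * ε * d l / (2 * N * psi N 1 t) ≤ r l := by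
        refine le_trans ?_ (hr l)
        gcongr
        exact psi_le_psi_one N (hj1 l) ht.le
      rw [div_le_iff₀ (by positivity)] at hle
      rw [← mul_div_assoc, le_div_iff₀ (by positivity)]
      linarith
    calc ∑ l, d l ≤ ∑ l, r l * (2 * N * psi N 1 t / (Real.exp t * ε)) :=
          Finset.sum_le_sum fun l _ => key l
      _ = (∑ l, r l) * (2 * N * psi N 1 t / (Real.exp t * ε)) := (Finset.sum_mul ..).symm
      _ ≤ Real.exp t * (2 * N * psi N 1 t / (Real.exp t * ε)) := by gcongr
      _ = 2 * N * psi N 1 t / ε := by field_simp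
  · rw [div_le_div_iff₀ hε (by positivity)]
    calc 2 * N * psi N 1 t * (t * ε) = 2 * N * ε * (t * psi N 1 t) := by ring
      _ ≤ 2 * N * ε * (Real.exp t - 1) := by gcongr; exact mul_psi_one_le hN ht.le
      _ = 2 * N * (Real.exp t - 1) * ε := by ring
end
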